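/- Let P₁,…,P_{n+1} be points of the closed unit ball of ℝⁿ such that Σ_{1≤k<j≤n+1} |P_k − P_j| ≥ √(n(n+1)³/2) − δ for some δ ≥ 0. Then (n+1)|G|² + Σ_{k=1}^{n+1}(1 − |P_k|²) ≤ C(n)·δ for an explicit constant C(n) depending only on n, where G is the barycenter of the P_k. In particular each |P_k|² ≥ 1 − C(n)δ and |G|² ≤ C(n)δ/(n+1). -/

import Mathlib

open Finset

theorem sum_sum_norm_sub_sq {ι E : Type*} [Fintype ι] [NormedAddCommGroup E]
    [InnerProductSpace ℝ E] (P : ι → E) :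
    ∑ k, ∑ j, ‖P k - P j‖ ^ 2 =
      2 * (Fintype.card ι : ℝ) * ∑ k, ‖P k‖ ^ 2 - 2 * ‖∑ k, P k‖ ^ 2 := by
  have h : ∑ k, ∑ j, inner ℝ (P k) (P j) = ‖∑ k, P k‖ ^ 2 := by
    rw [← real_inner_self_eq_norm_sq, sum_inner]
    simp_rw [inner_sum]
  simp_rw [norm_sub_sq_real, sum_add_distrib, sum_sub_distrib, ← mul_sum, h]
  simp only [sum_const, card_univ, nsmul_eq_mul, ← mul_sum]
  ring

theorem sum_offDiag_eq_two_mul_sum_lt {ι : Type*} [Fintype ι] [LinearOrder ι]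
    (f : ι → ι → ℝ) (hf : ∀ k j, f k j = f j k) :
    ∑ p ∈ (univ : Finset ι).offDiag, f p.1 p.2 =
      2 * ∑ k, ∑ j ∈ univ.filter (fun j => k < j), f k j := by
  have h₁ : ∑ p ∈ (univ : Finset ι).offDiag, f p.1 p.2 =
      ∑ k, ∑ j, if k ≠ j then f k j else 0 := by
    rw [← Fintype.sum_prod_type', ← sum_filter]
    congr 1
    ext p
    simp
  have h₂ : ∑ k, ∑ j, (if j < k then f k j else 0) =
      ∑ k, ∑ j, if k < j then f k j else 0 := by
    rw [sum_comm]
    simp_rw [hf]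
  simp_rw [sum_filter]
  rw [h₁, two_mul]
  nth_rewrite 1 [← h₂]
  simp_rw [← sum_add_distrib]
  refine sum_congr rfl fun k _ => sum_congr rfl fun j _ => ?_
  rcases lt_trichotomy k j with h | h | h
  · simp [h, h.ne, h.not_gt]
  · simp [h]
  · simp [h, h.ne', h.not_gt]

/-- The Cauchy–Schwarz bound for the sum of the pairwise distances of a finite family. -/
theorem two_mul_sq_sum_lt_norm_sub_le {ι E : Type*} [Fintype ι] [LinearOrder ι]
    [NormedAddCommGroup E] [InnerProductSpace ℝ E] (P : ι → E) :
    2 * (∑ k, ∑ j ∈ univ.filter (fun j => k < j), ‖P k - P j‖) ^ 2 ≤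
      ((Fintype.card ι : ℝ) ^ 2 - Fintype.card ι) *
        (Fintype.card ι * ∑ k, ‖P k‖ ^ 2 - ‖∑ k, P k‖ ^ 2) := by
  have hcs := sq_sum_le_card_mul_sum_sq (s := (univ : Finset ι).offDiag)
    (f := fun p => ‖P p.1 - P p.2‖)
  have hsq : ∑ p ∈ (univ : Finset ι).offDiag, ‖P p.1 - P p.2‖ ^ 2 =
      ∑ k, ∑ j, ‖P k - P j‖ ^ 2 := by
    rw [← Fintype.sum_prod_type']
    refine sum_subset (subset_univ _) fun p _ hp => ?_
    have : p.1 = p.2 := by simpa using hp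
    simp [this]
  have hcard : (((univ : Finset ι).offDiag.card : ℕ) : ℝ) =
      (Fintype.card ι : ℝ) ^ 2 - Fintype.card ι := by
    rw [offDiag_card, card_univ, Nat.cast_sub (Nat.le_mul_self _)]
    push_cast
    ring
  rw [sum_offDiag_eq_two_mul_sum_lt (fun k j => ‖P k - P j‖) fun k j => norm_sub_rev _ _,
    hsq, hcard, sum_sum_norm_sub_sq] at hcs
  linarith

/-- Quantitative stability of the extremal configuration for the `(n+1)`-extent of the unit
ball: if the sum of pairwise distances of `n+1` points of the closed unit ball of `ℝⁿ` is at
least `√(n(n+1)³/2) - δ`, then with the explicit constant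
`C(n) = 4√(n(n+1)³/2)/(n(n+1)²)` one has
`(n+1)|G|² + Σ_k (1-|P_k|²) ≤ C(n)δ`; in particular `|P_k|² ≥ 1 - C(n)δ` for each `k`
and `|G|² ≤ C(n)δ/(n+1)`. -/
theorem almost_extremal_stability (n : ℕ) (hn : 1 ≤ n)
    (P : Fin (n + 1) → EuclideanSpace ℝ (Fin n)) (hP : ∀ k, ‖P k‖ ≤ 1)
    (δ : ℝ) (hδ0 : 0 ≤ δ) (hδ1 : δ ≤ 1)
    (hsum : Real.sqrt (n * (n + 1) ^ 3 / 2) - δ ≤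
      ∑ k : Fin (n + 1), ∑ j ∈ Finset.univ.filter (fun j => k < j), ‖P k - P j‖) :
    (n + 1 : ℝ) * ‖((n + 1 : ℝ))⁻¹ • ∑ k : Fin (n + 1), P k‖ ^ 2 +
        ∑ k : Fin (n + 1), (1 - ‖P k‖ ^ 2) ≤
        (4 * Real.sqrt (n * (n + 1) ^ 3 / 2) / (n * (n + 1) ^ 2)) * δ ∧
      (∀ k, 1 - (4 * Real.sqrt (n * (n + 1) ^ 3 / 2) / (n * (n + 1) ^ 2)) * δ ≤ ‖P k‖ ^ 2) ∧
      ‖((n + 1 : ℝ))⁻¹ • ∑ k : Fin (n + 1), P k‖ ^ 2 ≤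
        (4 * Real.sqrt (n * (n + 1) ^ 3 / 2) / (n * (n + 1) ^ 2)) * δ / (n + 1) := by
  have hn1 : (1 : ℝ) ≤ n := by exact_mod_cast hn
  have hcs := two_mul_sq_sum_lt_norm_sub_le P
  set S := ∑ k : Fin (n + 1), ∑ j ∈ Finset.univ.filter (fun j => k < j), ‖P k - P j‖
  set T := Real.sqrt (n * (n + 1) ^ 3 / 2) with hT
  have hT0 : 0 ≤ T := Real.sqrt_nonneg _
  have hTsq : T ^ 2 = n * (n + 1) ^ 3 / 2 := Real.sq_sqrt (by positivity)
  have hS0 : 0 ≤ S := sum_nonneg fun _ _ => sum_nonneg fun _ _ => norm_nonneg _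
  have hTS : T ^ 2 - 2 * T * δ ≤ S ^ 2 := by
    rcases le_total δ T with h | h
    · nlinarith [pow_le_pow_left₀ (sub_nonneg.2 h) hsum 2, sq_nonneg δ]
    · nlinarith [mul_nonneg hT0 hδ0, mul_le_mul_of_nonneg_left h hT0, sq_nonneg S]
  have hG : ‖∑ k, P k‖ ^ 2 =
      (n + 1 : ℝ) ^ 2 * ‖((n + 1 : ℝ))⁻¹ • ∑ k : Fin (n + 1), P k‖ ^ 2 := by
    rw [norm_smul, Real.norm_of_nonneg (by positivity)]
    field_simp
  have hterm : ∀ k, 0 ≤ 1 - ‖P k‖ ^ 2 := fun k =>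
    sub_nonneg.2 (pow_le_one₀ (norm_nonneg _) (hP k))
  have hD : ∑ k, ‖P k‖ ^ 2 = (n + 1 : ℝ) - ∑ k, (1 - ‖P k‖ ^ 2) := by
    simp [sum_sub_distrib]
  rw [hG, hD, Fintype.card_fin] at hcs
  push_cast at hcs
  set g := ‖((n + 1 : ℝ))⁻¹ • ∑ k : Fin (n + 1), P k‖ ^ 2
  have hg : 0 ≤ g := by positivity
  have hD0 : 0 ≤ ∑ k, (1 - ‖P k‖ ^ 2) := sum_nonneg fun k _ => hterm k
  have hmain : (n + 1 : ℝ) * g + ∑ k, (1 - ‖P k‖ ^ 2) ≤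
      (4 * T / (n * (n + 1) ^ 2)) * δ := by
    rw [div_mul_eq_mul_div, le_div_iff₀ (by positivity)]
    linarith
  refine ⟨hmain, fun k => ?_, ?_⟩
  · have := single_le_sum (fun i _ => hterm i) (mem_univ k)
    have : 0 ≤ (n + 1 : ℝ) * g := by positivity
    linarith
  · rw [le_div_iff₀ (by positivity)]
    linarith
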